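/- arXiv:1207.3526 — 5 statements merged into one kernel-verified Lean document; each statement's English description precedes it below -/
import Mathlib

section
/- Let a, b, c, d, e ∈ ℂ and, in the polynomial ring ℂ[X,Y,Z], set c12 = a·Z, c13 = b·Y, c14 = c·Y, c15 = d·X, c16 = -c·Z, c23 = e·X, c24 = -b·X, c25 = -e·Z, c26 = -d·Y, c34 = -d·Z, c35 = e·Y, c36 = -a·X, c45 = a·Y, c46 = c·X, c56 = -b·Z. Then the fifteen Plücker relations c12·c34 - c13·c24 + c14·c23 = 0, c12·c35 - c13·c25 + c15·c23 = 0, c12·c36 - c13·c26 + c16·c23 = 0, c12·c45 - c14·c25 + c15·c24 = 0, c12·c46 - c14·c26 + c16·c24 = 0, c12·c56 - c15·c26 + c16·c25 = 0, c13·c45 - c14·c35 + c15·c34 = 0, c13·c46 - c14·c36 + c16·c34 = 0, c13·c56 - c15·c36 + c16·c35 = 0, c14·c56 - c15·c46 + c16·c45 = 0, c23·c45 - c24·c35 + c25·c34 = 0, c23·c46 - c24·c36 + c26·c34 = 0, c23·c56 - c25·c36 + c26·c35 = 0, c24·c56 - c25·c46 + c26·c45 = 0, c34·c56 - c35·c46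 + c36·c45 = 0 all hold in ℂ[X,Y,Z] if and only if a + b = 0, d = 0 and a² + c·e = 0. Equivalently, the corresponding section is totally decomposable exactly when [a : b : c : d : e] lies on the smooth conic {a + b = 0, d = 0, a² + ce = 0} in ℙ⁴. -/
open MvPolynomial

/-- **Proposition 3.4.** With `c_ij` the coordinates (with respect to the basis `{X, Y, Z}`
of `H⁰(A, L)`) of a `K(L⁻¹)`-invariant section, the fifteen Plücker relations hold in
`ℂ[X,Y,Z]` if and only if `a + b = 0`, `d = 0` and `a² + c·e = 0`, i.e. exactly when
`[a : b : c : d : e]` lies on the smooth conic `{a + b = 0, d = 0, a² + ce = 0}` in `ℙ⁴`. -/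
theorem pluecker_relations_iff_conic (a b c d e : ℂ)
    (c12 c13 c14 c15 c16 c23 c24 c25 c26 c34 c35 c36 c45 c46 c56 : MvPolynomial (Fin 3) ℂ)
    (h12 : c12 = C a * X 2) (h13 : c13 = C b * X 1) (h14 : c14 = C c * X 1)
    (h15 : c15 = C d * X 0) (h16 : c16 = -(C c * X 2)) (h23 : c23 = C e * X 0)
    (h24 : c24 = -(C b * X 0)) (h25 : c25 = -(C e * X 2)) (h26 : c26 = -(C d * X 1))
    (h34 : c34 = -(C d * X 2)) (h35 : c35 = C e * X 1) (h36 : c36 = -(C a * X 0))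
    (h45 : c45 = C a * X 1) (h46 : c46 = C c * X 0) (h56 : c56 = -(C b * X 2)) :
    (c12 * c34 - c13 * c24 + c14 * c23 = 0 ∧
     c12 * c35 - c13 * c25 + c15 * c23 = 0 ∧
     c12 * c36 - c13 * c26 + c16 * c23 = 0 ∧
     c12 * c45 - c14 * c25 + c15 * c24 = 0 ∧
     c12 * c46 - c14 * c26 + c16 * c24 = 0 ∧
     c12 * c56 - c15 * c26 + c16 * c25 = 0 ∧
     c13 * c45 - c14 * c35 + c15 * c34 = 0 ∧
     c13 * c46 - c14 * c36 + c16 * c34 = 0 ∧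
     c13 * c56 - c15 * c36 + c16 * c35 = 0 ∧
     c14 * c56 - c15 * c46 + c16 * c45 = 0 ∧
     c23 * c45 - c24 * c35 + c25 * c34 = 0 ∧
     c23 * c46 - c24 * c36 + c26 * c34 = 0 ∧
     c23 * c56 - c25 * c36 + c26 * c35 = 0 ∧
     c24 * c56 - c25 * c46 + c26 * c45 = 0 ∧
     c34 * c56 - c35 * c46 + c36 * c45 = 0) ↔
    (a + b = 0 ∧ d = 0 ∧ a ^ 2 + c * e = 0) := by
  subst h12 h13 h14 h15 h16 h23 h24 h25 h26 h34 h35 h36 h45 h46 h56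
  constructor
  · rintro ⟨r₁, -, r₃, -, -, r₆, -⟩
    have hb : b ^ 2 + c * e = 0 := by
      have h := congrArg (eval ![1, 1, 0]) r₁
      simp at h
      linear_combination h
    have ha : a ^ 2 + c * e = 0 := by
      have h := congrArg (eval ![1, 0, 1]) r₃
      simp at h
      linear_combination -h
    have hab : a * b - c * e = 0 := by
      have h := congrArg (eval ![0, 0, 1]) r₆
      simp at h
      linear_combination -h
    have hd : d ^ 2 = 0 := by
      have h := congrArg (eval ![1, 1, 0]) r₆
      simp at h
      simp [h]
    have hsum : (a + b) ^ 2 = 0 := by linear_combination ha + hb + 2 * hab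
    exact ⟨pow_eq_zero_iff two_ne_zero |>.mp hsum, pow_eq_zero_iff two_ne_zero |>.mp hd, ha⟩
  · rintro ⟨hab, rfl, hconic⟩
    obtain rfl : b = -a := by linear_combination hab
    have h : (C a ^ 2 + C c * C e : MvPolynomial (Fin 3) ℂ) = 0 := by
      rw [← C_pow, ← C_mul, ← C_add, hconic, C_0]
    simp only [C_neg, C_0]
    refine ⟨?_, ?_, ?_, ?_, ?_, ?_, ?_, ?_, ?_, ?_, ?_, ?_, ?_, ?_, ?_⟩
    · linear_combination X 0 * X 1 * h
    · ring
    · linear_combination -(X 0 * X 2) * h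
    · linear_combination X 1 * X 2 * h
    · ring
    · linear_combination X 2 ^ 2 * h
    · linear_combination -X 1 ^ 2 * h
    · ring
    · linear_combination -(X 1 * X 2) * h
    · ring
    · ring
    · linear_combination X 0 ^ 2 * h
    · ring
    · linear_combination X 0 * X 2 * h
    · linear_combination -(X 0 * X 1) * h
end

section
/- The subspace {w ∈ W : Ŝw = w and T̂w = w} of vectors of W fixed by both Ŝ and T̂ has dimension 5; it is spanned by the five linearly independent vectors v₁ = -(XZ∧Z²)⊗e₁ + (Y²∧YZ)⊗e₂ + (X²∧XY)⊗e₃, v₂ = -(XY∧Y²)⊗e₁ + (X²∧XZ)⊗e₂ + (Z²∧YZ)⊗e₃, v₃ = (Y²∧Z²)⊗e₁ + (X²∧Y²)⊗e₂ - (X²∧Z²)⊗e₃, v₄ = (X²∧YZ)⊗e₁ - (XY∧Z²)⊗e₂ - (XZ∧Y²)⊗e₃, v₅ = (XY∧XZ)⊗e₁ + (XZ∧YZ)⊗e₂ - (XY∧YZ)⊗e₃. -/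
set_option synthInstance.maxHeartbeats 1000000
set_option maxHeartbeats 1000000

open MvPolynomial TensorProduct

/-- The 6-dimensional space `Q` of homogeneous quadratic polynomials in `X, Y, Z`
(identified with `S²V^∨`). -/
noncomputable abbrev quadForms : Submodule ℂ (MvPolynomial (Fin 3) ℂ) :=
  homogeneousSubmodule (Fin 3) ℂ 2

/-- `W := ⋀²Q ⊗ V`, the 45-dimensional complex vector space
(identified with `⋀²(S²V^∨) ⊗ ⋀³V ⊗ V`). -/
noncomputable abbrev Wspace :=
  (⋀[ℂ]^2 ↥quadForms) ⊗[ℂ] (Fin 3 → ℂ)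

/-- The wedge `q₁ ∧ q₂ ∈ ⋀²Q` of two quadratic forms. -/
noncomputable def wedge (q₁ q₂ : quadForms) : ⋀[ℂ]^2 ↥quadForms :=
  ⟨ExteriorAlgebra.ιMulti ℂ 2 ![q₁, q₂],
    ExteriorAlgebra.ιMulti_range ℂ 2 (Set.mem_range_self _)⟩

/-- The quadratic monomial `X i · X j` as an element of `Q`. -/
noncomputable def qm (i j : Fin 3) : quadForms :=
  ⟨X i * X j, (mem_homogeneousSubmodule _ _).2
    ((isHomogeneous_X ℂ i).mul (isHomogeneous_X ℂ j))⟩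

/-- The standard basis vector `eᵢ` of `V = ℂ³`. -/
noncomputable def stdVec (i : Fin 3) : Fin 3 → ℂ := Pi.single i 1

/-- `v₁ = -(XZ∧Z²)⊗e₁ + (Y²∧YZ)⊗e₂ + (X²∧XY)⊗e₃`. -/
noncomputable def v₁ : Wspace :=
  -(wedge (qm 0 2) (qm 2 2) ⊗ₜ[ℂ] stdVec 0) + wedge (qm 1 1) (qm 1 2) ⊗ₜ[ℂ] stdVec 1 +
    wedge (qm 0 0) (qm 0 1) ⊗ₜ[ℂ] stdVec 2

/-- `v₂ = -(XY∧Y²)⊗e₁ + (X²∧XZ)⊗e₂ + (Z²∧YZ)⊗e₃`. -/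
noncomputable def v₂ : Wspace :=
  -(wedge (qm 0 1) (qm 1 1) ⊗ₜ[ℂ] stdVec 0) + wedge (qm 0 0) (qm 0 2) ⊗ₜ[ℂ] stdVec 1 +
    wedge (qm 2 2) (qm 1 2) ⊗ₜ[ℂ] stdVec 2

/-- `v₃ = (Y²∧Z²)⊗e₁ + (X²∧Y²)⊗e₂ - (X²∧Z²)⊗e₃`. -/
noncomputable def v₃ : Wspace :=
  wedge (qm 1 1) (qm 2 2) ⊗ₜ[ℂ] stdVec 0 + wedge (qm 0 0) (qm 1 1) ⊗ₜ[ℂ] stdVec 1 -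
    wedge (qm 0 0) (qm 2 2) ⊗ₜ[ℂ] stdVec 2

/-- `v₄ = (X²∧YZ)⊗e₁ - (XY∧Z²)⊗e₂ - (XZ∧Y²)⊗e₃`. -/
noncomputable def v₄ : Wspace :=
  wedge (qm 0 0) (qm 1 2) ⊗ₜ[ℂ] stdVec 0 - wedge (qm 0 1) (qm 2 2) ⊗ₜ[ℂ] stdVec 1 -
    wedge (qm 0 2) (qm 1 1) ⊗ₜ[ℂ] stdVec 2

/-- `v₅ = (XY∧XZ)⊗e₁ + (XZ∧YZ)⊗e₂ - (XY∧YZ)⊗e₃`. -/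
noncomputable def v₅ : Wspace :=
  wedge (qm 0 1) (qm 0 2) ⊗ₜ[ℂ] stdVec 0 + wedge (qm 0 2) (qm 1 2) ⊗ₜ[ℂ] stdVec 1 -
    wedge (qm 0 1) (qm 1 2) ⊗ₜ[ℂ] stdVec 2

lemma qm_comm (i j : Fin 3) : qm i j = qm j i :=
  Subtype.ext (mul_comm _ _)

lemma wedge_eq_ιMulti (p q : quadForms) :
    wedge p q = exteriorPower.ιMulti ℂ 2 ![p, q] := rfl

lemma wedge_self (q : quadForms) : wedge q q = 0 := by
  rw [wedge_eq_ιMulti]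
  exact AlternatingMap.map_eq_zero_of_eq _ _ (i := 0) (j := 1) rfl (by decide)

lemma wedge_swap (p q : quadForms) : wedge p q = -wedge q p := by
  rw [wedge_eq_ιMulti, wedge_eq_ιMulti,
    ← AlternatingMap.map_swap _ ![q, p] (i := 0) (j := 1) (by decide)]
  congr 1
  ext i
  fin_cases i <;> simp

lemma wedge_smul_smul (a b : ℂ) (p q : quadForms) :
    wedge (a • p) (b • q) = (a * b) • wedge p q := by
  have h := (exteriorPower.ιMulti ℂ 2).toMultilinearMap.map_smul_univ ![a, b] ![p, q]
  have he : ![a • p, b • q] = fun i => ![a, b] i • ![p, q] i := by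
    ext i
    fin_cases i <;> simp
  rw [Fin.prod_univ_two] at h
  rw [wedge_eq_ιMulti, wedge_eq_ιMulti, he]
  exact h

lemma span_range_qm :
    Submodule.span ℂ (Set.range fun x : Fin 3 × Fin 3 => qm x.1 x.2) = ⊤ := by
  apply Submodule.map_injective_of_injective quadForms.subtype_injective
  rw [Submodule.map_span, Submodule.map_top, Submodule.range_subtype]
  change _ = homogeneousSubmodule (Fin 3) ℂ 2
  rw [← homogeneousSubmodule_one_pow, homogeneousSubmodule_one_eq_span_X, pow_two,
    Submodule.span_mul_span]
  congr 1
  ext p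
  simp [Set.mem_mul, qm]

/-- The monomial tensor `(XᵢXⱼ ∧ XₖXₗ) ⊗ eₘ`. -/
noncomputable def monomialTensor (i j k l m : Fin 3) : Wspace :=
  wedge (qm i j) (qm k l) ⊗ₜ[ℂ] stdVec m

lemma monomialTensor_swap (i j k l m : Fin 3) :
    monomialTensor i j k l m = -monomialTensor k l i j m := by
  rw [monomialTensor, wedge_swap, neg_tmul, monomialTensor]

lemma monomialTensor_self (i j m : Fin 3) : monomialTensor i j i j m = 0 := by
  rw [monomialTensor, wedge_self, zero_tmul]

lemma monomialTensor_comm_left (i j k l m : Fin 3) :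
    monomialTensor i j k l m = monomialTensor j i k l m := by
  rw [monomialTensor, qm_comm i j, monomialTensor]

lemma monomialTensor_comm_right (i j k l m : Fin 3) :
    monomialTensor i j k l m = monomialTensor i j l k m := by
  rw [monomialTensor, qm_comm k l, monomialTensor]

lemma span_monomialTensor :
    Submodule.span ℂ {w : Wspace | ∃ i j k l m, monomialTensor i j k l m = w} = ⊤ := by
  have hV : Submodule.span ℂ (Set.range stdVec) = (⊤ : Submodule ℂ (Fin 3 → ℂ)) := by
    convert (Pi.basisFun ℂ (Fin 3)).span_eq using 3
    ext1 i
    simp [stdVec]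
  rw [eq_top_iff, ← span_tmul_eq_top, Submodule.span_le]
  rintro _ ⟨x, y, rfl⟩
  have hx : x ∈ Submodule.span ℂ _ :=
    (exteriorPower.ιMulti_span_of_span ℂ 2 quadForms span_range_qm).symm ▸ Submodule.mem_top
  have hy : y ∈ Submodule.span ℂ _ := hV.symm ▸ Submodule.mem_top
  have h := Submodule.apply_mem_map₂ (mk ℂ _ _) hx hy
  rw [Submodule.map₂_span_span] at h
  refine Submodule.span_mono ?_ h
  rintro _ ⟨_, ⟨a, ha, rfl⟩, _, ⟨m, rfl⟩, rfl⟩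
  obtain ⟨⟨i, j⟩, hij⟩ := ha ⟨0, rfl⟩
  obtain ⟨⟨k, l⟩, hkl⟩ := ha ⟨1, rfl⟩
  refine ⟨i, j, k, l, m, ?_⟩
  have : a = ![qm i j, qm k l] := by
    ext1 n
    fin_cases n
    · exact hij.symm
    · exact hkl.symm
  rw [this]
  rfl

/-- The span of `v₁, …, v₅`. -/
noncomputable def spanV : Submodule ℂ Wspace :=
  Submodule.span ℂ {v₁, v₂, v₃, v₄, v₅}

/-- The sum of the orbit of a monomial tensor under the cyclic shift of coordinates. -/
noncomputable def orbitSum (i j k l m : Fin 3) : Wspace :=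
  monomialTensor i j k l m + monomialTensor (i + 1) (j + 1) (k + 1) (l + 1) (m + 2) +
    monomialTensor (i + 2) (j + 2) (k + 2) (l + 2) (m + 1)

lemma orbitSum_swap (i j k l m : Fin 3) :
    orbitSum i j k l m = (-1 : ℂ) • orbitSum k l i j m := by
  have h (i j k l m : Fin 3) :
      monomialTensor i j k l m = (-1 : ℂ) • monomialTensor k l i j m := by
    rw [monomialTensor, wedge_swap, ← neg_one_smul ℂ, ← smul_tmul', monomialTensor]
  simp only [orbitSum, smul_add, ← h]

lemma orbitSum_self (i j m : Fin 3) : orbitSum i j i j m = 0 := by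
  simp only [orbitSum, monomialTensor_self, add_zero]

lemma orbitSum_comm_left (i j k l m : Fin 3) : orbitSum i j k l m = orbitSum j i k l m := by
  simp only [orbitSum, monomialTensor_comm_left i, monomialTensor_comm_left (i + 1),
    monomialTensor_comm_left (i + 2)]

lemma orbitSum_comm_right (i j k l m : Fin 3) : orbitSum i j k l m = orbitSum i j l k m := by
  simp only [orbitSum, monomialTensor_comm_right _ _ k, monomialTensor_comm_right _ _ (k + 1),
    monomialTensor_comm_right _ _ (k + 2)]

lemma orbitSum_shift (i j k l m : Fin 3) :
    orbitSum i j k l m = orbitSum (i + 1) (j + 1) (k + 1) (l + 1) (m + 2) := by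
  have h1 (a : Fin 3) : a + 1 + 1 = a + 2 := by grind
  have h2 (a : Fin 3) : a + 1 + 2 = a := by grind
  have h3 (a : Fin 3) : a + 2 + 2 = a + 1 := by grind
  have h4 (a : Fin 3) : a + 2 + 1 = a := by grind
  simp only [orbitSum, h1, h2, h3, h4]
  abel

lemma v₁_eq_orbitSum : v₁ = orbitSum 2 2 0 2 0 := by
  rw [v₁, ← monomialTensor, ← monomialTensor, ← monomialTensor, orbitSum]
  simp only [Fin.isValue, Fin.reduceAdd]
  rw [monomialTensor_swap 2 2 0 2, monomialTensor_comm_right 0 0 1 0, monomialTensor_comm_right 1 1 2 1]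
  abel

lemma v₂_eq_orbitSum : v₂ = orbitSum 1 1 0 1 0 := by
  rw [v₂, ← monomialTensor, ← monomialTensor, ← monomialTensor, orbitSum]
  simp only [Fin.isValue, Fin.reduceAdd]
  rw [monomialTensor_swap 1 1 0 1, monomialTensor_comm_right 0 0 2 0]
  abel

lemma v₃_eq_orbitSum : v₃ = orbitSum 1 1 2 2 0 := by
  rw [v₃, ← monomialTensor, ← monomialTensor, ← monomialTensor, orbitSum]
  simp only [Fin.isValue, Fin.reduceAdd]
  rw [monomialTensor_swap 2 2 0 0]
  abel

lemma v₄_eq_orbitSum : v₄ = orbitSum 0 0 1 2 0 := by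
  rw [v₄, ← monomialTensor, ← monomialTensor, ← monomialTensor, orbitSum]
  simp only [Fin.isValue, Fin.reduceAdd]
  rw [monomialTensor_comm_right 1 1 2 0, monomialTensor_swap 1 1 0 2, monomialTensor_swap 2 2 0 1]
  abel

lemma v₅_eq_orbitSum : v₅ = orbitSum 0 1 0 2 0 := by
  rw [v₅, ← monomialTensor, ← monomialTensor, ← monomialTensor, orbitSum]
  simp only [Fin.isValue, Fin.reduceAdd]
  rw [monomialTensor_comm_right 1 2 1 0, monomialTensor_swap 1 2 0 1, monomialTensor_comm_left 2 0 2 1, monomialTensor_comm_right 0 2 2 1]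
  abel

lemma orbitSum_mem_spanV_of_le (i j k l : Fin 3) (h : i + j + k + l = 0)
    (hij : i ≤ j) (hkl : k ≤ l) : orbitSum i j k l 0 ∈ spanV := by
  have h₁ : orbitSum 2 2 0 2 0 ∈ spanV :=
    v₁_eq_orbitSum ▸ Submodule.subset_span (by simp)
  have h₂ : orbitSum 1 1 0 1 0 ∈ spanV :=
    v₂_eq_orbitSum ▸ Submodule.subset_span (by simp)
  have h₃ : orbitSum 1 1 2 2 0 ∈ spanV :=
    v₃_eq_orbitSum ▸ Submodule.subset_span (by simp)
  have h₄ : orbitSum 0 0 1 2 0 ∈ spanV :=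
    v₄_eq_orbitSum ▸ Submodule.subset_span (by simp)
  have h₅ : orbitSum 0 1 0 2 0 ∈ spanV :=
    v₅_eq_orbitSum ▸ Submodule.subset_span (by simp)
  have hneg {a b c d : Fin 3} (hm : orbitSum a b c d 0 ∈ spanV) : orbitSum c d a b 0 ∈ spanV := by
    rw [orbitSum_swap]
    exact Submodule.smul_mem _ _ hm
  have hcases : ∀ i j k l : Fin 3, i + j + k + l = 0 → i ≤ j → k ≤ l →
      (i, j) = (k, l) ∨ (i, j, k, l) ∈ [(2, 2, 0, 2), (0, 2, 2, 2), (1, 1, 0, 1), (0, 1, 1, 1),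
        (1, 1, 2, 2), (2, 2, 1, 1), (0, 0, 1, 2), (1, 2, 0, 0), (0, 1, 0, 2), (0, 2, 0, 1)] := by
    decide
  have hc := hcases i j k l h hij hkl
  simp only [List.mem_cons, List.not_mem_nil, or_false, Prod.mk.injEq] at hc
  rcases hc with ⟨rfl, rfl⟩ | h | h | h | h | h | h | h | h | h | h
  · rw [orbitSum_self]
    exact zero_mem _
  all_goals obtain ⟨rfl, rfl, rfl, rfl⟩ := h
  exacts [h₁, hneg h₁, h₂, hneg h₂, h₃, hneg h₃, h₄, hneg h₄, h₅, hneg h₅]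

lemma orbitSum_mem_spanV (i j k l m : Fin 3) (h : i + j + k + l + m = 0) :
    orbitSum i j k l m ∈ spanV := by
  have h0 (i j k l : Fin 3) (h : i + j + k + l = 0) : orbitSum i j k l 0 ∈ spanV := by
    rcases le_total i j with hij | hij <;> rcases le_total k l with hkl | hkl
    · exact orbitSum_mem_spanV_of_le _ _ _ _ h hij hkl
    · rw [orbitSum_comm_right]
      exact orbitSum_mem_spanV_of_le _ _ _ _ (by rw [← h]; abel) hij hkl
    · rw [orbitSum_comm_left]
      exact orbitSum_mem_spanV_of_le _ _ _ _ (by rw [← h]; abel) hij hkl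
    · rw [orbitSum_comm_left, orbitSum_comm_right]
      exact orbitSum_mem_spanV_of_le _ _ _ _ (by rw [← h]; abel) hij hkl
  fin_cases m
  · exact h0 i j k l (by simpa using h)
  · rw [orbitSum_shift]
    exact h0 _ _ _ _ (by simp only [Fin.mk_one] at h; grind)
  · rw [orbitSum_shift, orbitSum_shift]
    exact h0 _ _ _ _ (by simp only [Fin.reduceFinMk] at h; grind)

/-- The coefficient of `XₐX_b` of a quadratic form. -/
noncomputable def quadCoeff (a b : Fin 3) : Module.Dual ℂ quadForms :=
  (lcoeff ℂ (Finsupp.single a 1 + Finsupp.single b 1)).comp quadForms.subtype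

lemma quadCoeff_qm (a b i j : Fin 3) :
    quadCoeff a b (qm i j) = if (i = a ∧ j = b) ∨ (i = b ∧ j = a) then 1 else 0 := by
  have h : (X i * X j : MvPolynomial (Fin 3) ℂ) =
      monomial (Finsupp.single i 1 + Finsupp.single j 1) 1 := by
    simp [X, monomial_mul]
  simp [quadCoeff, qm, h, coeff_monomial, Finsupp.single_add_single_eq_single_add_single]

/-- The coordinate of `(XₐX_b ∧ X_cX_d) ⊗ e₁` on `W`. -/
noncomputable def tensorCoord (a b c d : Fin 3) : Module.Dual ℂ Wspace :=
  LinearMap.mul' ℂ ℂ ∘ₗ TensorProduct.map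
    (exteriorPower.alternatingMapToDual ℂ quadForms 2 ![quadCoeff a b, quadCoeff c d])
    (LinearMap.proj 0)

lemma tensorCoord_tmul (a b c d : Fin 3) (p q : quadForms) (x : Fin 3 → ℂ) :
    tensorCoord a b c d (wedge p q ⊗ₜ[ℂ] x) =
      (quadCoeff a b p * quadCoeff c d q - quadCoeff c d p * quadCoeff a b q) * x 0 := by
  simp [tensorCoord, wedge_eq_ιMulti, Matrix.det_fin_two]

lemma tensorCoord_orbitSum (a b c d i j k l : Fin 3) :
    tensorCoord a b c d (orbitSum i j k l 0) =
      quadCoeff a b (qm i j) * quadCoeff c d (qm k l) -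
        quadCoeff c d (qm i j) * quadCoeff a b (qm k l) := by
  simp [orbitSum, monomialTensor, tensorCoord_tmul, stdVec]

lemma linearIndependent_v : LinearIndependent ℂ ![v₁, v₂, v₃, v₄, v₅] := by
  rw [Fintype.linearIndependent_iffₛ]
  intro f g hfg
  have h (a b c d : Fin 3) := congrArg (tensorCoord a b c d) hfg
  simp only [Fin.sum_univ_five, Matrix.cons_val, v₁_eq_orbitSum, v₂_eq_orbitSum, v₃_eq_orbitSum,
    v₄_eq_orbitSum, v₅_eq_orbitSum, map_add, map_smul, tensorCoord_orbitSum, quadCoeff_qm] at h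
  intro i
  fin_cases i
  · simpa using h 2 2 0 2
  · simpa using h 1 1 0 1
  · simpa using h 1 1 2 2
  · simpa using h 0 0 1 2
  · simpa using h 0 1 0 2

/-- The subspace `{w ∈ W : Ŝw = w, T̂w = w}` of vectors fixed by both `Ŝ` and `T̂` has
dimension `5`: it is spanned by the five linearly independent vectors `v₁, …, v₅`. -/
theorem heisenberg_invariants_of_W (ω : ℂ) (hω : IsPrimitiveRoot ω 3)
    (s t : quadForms →ₗ[ℂ] quadForms)
    (hs : ∀ q : quadForms, (s q : MvPolynomial (Fin 3) ℂ) =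
      aeval ![(X 0 : MvPolynomial (Fin 3) ℂ), C ω * X 1, C (ω ^ 2) * X 2]
        (q : MvPolynomial (Fin 3) ℂ))
    (ht : ∀ q : quadForms, (t q : MvPolynomial (Fin 3) ℂ) =
      aeval ![(X 1 : MvPolynomial (Fin 3) ℂ), X 2, X 0] (q : MvPolynomial (Fin 3) ℂ))
    (S T : (Fin 3 → ℂ) →ₗ[ℂ] (Fin 3 → ℂ))
    (hS : S = Matrix.toLin' !![1, 0, 0; 0, ω, 0; 0, 0, ω ^ 2])
    (hT : T = Matrix.toLin' !![0, 1, 0; 0, 0, 1; 1, 0, 0])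
    (Shat That : Module.End ℂ Wspace)
    (hShat : ∀ (q₁ q₂ : quadForms) (x : Fin 3 → ℂ),
      Shat ((wedge q₁ q₂ : ⋀[ℂ]^2 ↥quadForms) ⊗ₜ[ℂ] x) =
        (wedge (s q₁) (s q₂) : ⋀[ℂ]^2 ↥quadForms) ⊗ₜ[ℂ] S x)
    (hThat : ∀ (q₁ q₂ : quadForms) (x : Fin 3 → ℂ),
      That ((wedge q₁ q₂ : ⋀[ℂ]^2 ↥quadForms) ⊗ₜ[ℂ] x) =
        (wedge (t q₁) (t q₂) : ⋀[ℂ]^2 ↥quadForms) ⊗ₜ[ℂ] T x) :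
    LinearIndependent ℂ ![v₁, v₂, v₃, v₄, v₅] ∧
    (∀ w : Wspace,
      w ∈ Submodule.span ℂ ({v₁, v₂, v₃, v₄, v₅} : Set Wspace) ↔ Shat w = w ∧ That w = w) ∧
    Module.rank ℂ ↥(Submodule.span ℂ ({v₁, v₂, v₃, v₄, v₅} : Set Wspace)) = 5 := by
  have hSe (m : Fin 3) : S (stdVec m) = ω ^ (m : ℕ) • stdVec m := by
    subst hS
    ext n
    fin_cases m <;> fin_cases n <;> simp [stdVec, Matrix.mulVec, dotProduct, Fin.sum_univ_three]
  have hTe (m : Fin 3) : T (stdVec m) = stdVec (m + 2) := by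
    subst hT
    ext n
    fin_cases m <;> fin_cases n <;> simp [stdVec, Matrix.mulVec, dotProduct, Fin.sum_univ_three]
  have hsq (i j : Fin 3) : s (qm i j) = ω ^ (i + j : ℕ) • qm i j := by
    have hX (i : Fin 3) : (![(X 0 : MvPolynomial (Fin 3) ℂ), C ω * X 1, C (ω ^ 2) * X 2]) i =
        C (ω ^ (i : ℕ)) * X i := by
      fin_cases i <;> simp
    apply Subtype.ext
    simp only [hs, qm, map_mul, aeval_X, hX, Submodule.coe_smul, smul_eq_C_mul, pow_add]
    ring
  have htq (i j : Fin 3) : t (qm i j) = qm (i + 1) (j + 1) := by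
    have hX (i : Fin 3) : (![(X 1 : MvPolynomial (Fin 3) ℂ), X 2, X 0]) i = X (i + 1) := by
      fin_cases i <;> rfl
    apply Subtype.ext
    simp only [ht, qm, map_mul, aeval_X, hX]
  have hSm (i j k l m : Fin 3) : Shat (monomialTensor i j k l m) =
      ω ^ (i + j + k + l + m : ℕ) • monomialTensor i j k l m := by
    rw [monomialTensor, hShat, hsq, hsq, hSe, wedge_smul_smul, smul_tmul_smul]
    congr 1
    ring
  have hTm (i j k l m : Fin 3) : That (monomialTensor i j k l m) =
      monomialTensor (i + 1) (j + 1) (k + 1) (l + 1) (m + 2) := by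
    rw [monomialTensor, hThat, htq, htq, hTe, monomialTensor]
  have hval (i j k l m : Fin 3) :
      3 ∣ (i + j + k + l + m : ℕ) ↔ i + j + k + l + m = 0 := by
    revert i j k l m
    decide
  have hTo (i j k l m : Fin 3) : That (orbitSum i j k l m) = orbitSum i j k l m := by
    conv_rhs => rw [orbitSum_shift]
    have h21 (a : Fin 3) : a + 2 + 1 = a + 1 + 2 := by grind
    simp only [orbitSum, map_add, hTm, h21]
  have hSo (i j k l m : Fin 3) (h : i + j + k + l + m = 0) :
      Shat (orbitSum i j k l m) = orbitSum i j k l m := by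
    have key (i j k l m : Fin 3) (h : i + j + k + l + m = 0) :
        Shat (monomialTensor i j k l m) = monomialTensor i j k l m := by
      rw [hSm, (hω.pow_eq_one_iff_dvd _).2 ((hval _ _ _ _ _).2 h), one_smul]
    rw [orbitSum, map_add, map_add, key _ _ _ _ _ h, key, key] <;> grind
  have hfix (v : Wspace) (hv : v ∈ ({v₁, v₂, v₃, v₄, v₅} : Set Wspace)) :
      Shat v = v ∧ That v = v := by
    simp only [Set.mem_insert_iff, Set.mem_singleton_iff, v₁_eq_orbitSum, v₂_eq_orbitSum,
      v₃_eq_orbitSum, v₄_eq_orbitSum, v₅_eq_orbitSum] at hv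
    rcases hv with rfl | rfl | rfl | rfl | rfl <;> exact ⟨hSo _ _ _ _ _ (by decide), hTo _ _ _ _ _⟩
  have havg (w : Wspace) : w ∈ spanV.comap ((1 + That + That ^ 2) * (1 + Shat + Shat ^ 2)) := by
    have hw : w ∈ Submodule.span ℂ _ := span_monomialTensor.symm ▸ Submodule.mem_top
    refine Submodule.span_le.2 ?_ hw
    rintro _ ⟨i, j, k, l, m, rfl⟩
    set c := ω ^ (i + j + k + l + m : ℕ) with hc
    have hA : (1 + Shat + Shat ^ 2 : Module.End ℂ Wspace) (monomialTensor i j k l m) =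
        (1 + c + c ^ 2) • monomialTensor i j k l m := by
      simp [pow_two, hSm, ← hc, add_smul, mul_smul]
    have hB : (1 + That + That ^ 2 : Module.End ℂ Wspace) (monomialTensor i j k l m) = orbitSum i j k l m := by
      simp [pow_two, hTm, orbitSum, add_assoc]
    rw [SetLike.mem_coe, Submodule.mem_comap, Module.End.mul_apply, hA, map_smul, hB]
    by_cases h : i + j + k + l + m = 0
    · exact Submodule.smul_mem _ _ (orbitSum_mem_spanV _ _ _ _ _ h)
    · have hc1 : c ≠ 1 := fun h1 => h ((hval _ _ _ _ _).1 ((hω.pow_eq_one_iff_dvd _).1 h1))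
      have hc3 : c ^ 3 = 1 := by rw [hc, pow_right_comm, hω.pow_eq_one, one_pow]
      have h0 : 1 + c + c ^ 2 = 0 := by
        apply mul_left_cancel₀ (sub_ne_zero.2 hc1)
        linear_combination hc3
      rw [h0, zero_smul]
      exact zero_mem _
  refine ⟨linearIndependent_v, fun w => ⟨fun hw => ?_, fun ⟨hSw, hTw⟩ => ?_⟩, ?_⟩
  · have hle : Submodule.span ℂ ({v₁, v₂, v₃, v₄, v₅} : Set Wspace) ≤
        LinearMap.eqLocus Shat LinearMap.id ⊓ LinearMap.eqLocus That LinearMap.id :=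
      Submodule.span_le.2 hfix
    exact hle hw
  · have h := havg w
    have h9 : ((1 + That + That ^ 2) * (1 + Shat + Shat ^ 2) : Module.End ℂ Wspace) w = (9 : ℂ) • w := by
      simp only [Module.End.mul_apply, LinearMap.add_apply, Module.End.one_apply, pow_two, hSw,
        map_add, hTw]
      module
    rw [Submodule.mem_comap, h9] at h
    exact (Submodule.smul_mem_iff _ (by norm_num)).1 h
  · have h := rank_span linearIndependent_v
    rw [Cardinal.mk_range_eq _ linearIndependent_v.injective] at h
    have hr : Set.range ![v₁, v₂, v₃, v₄, v₅] = {v₁, v₂, v₃, v₄, v₅} := by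
      simp only [Matrix.range_cons, Matrix.range_empty, Set.union_empty, Set.singleton_union]
    rw [hr] at h
    simpa using h
end

section
/- Let (a,c) ∈ ℂ² ∖ {(0,0)} satisfy a = 0, or c = 0, or a³ = c³, or a³ = -8c³ (equivalently [a:c] ∈ T₁ ∪ T₂ = {[1:1],[ω:1],[ω²:1],[1:0],[-2:1],[-2ω:1],[-2ω²:1],[0:1]}). Then the sextic F_{a,c} is twice a triangle: there exist λ ∈ ℂ ∖ {0} and three pairwise non-proportional linear forms ℓ₁, ℓ₂, ℓ₃ ∈ ℂ[X,Y,Z] such that F_{a,c} = λ·(ℓ₁·ℓ₂·ℓ₃)². -/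
open MvPolynomial

/-- The homogeneous sextic `F_{a,c} ∈ ℂ[X,Y,Z]`, the equation of the branch curve `B`
of the quadruple cover `α : S → A` (viewed as a plane sextic `𝐁`). -/
noncomputable def branchSextic (a c : ℂ) : MvPolynomial (Fin 3) ℂ :=
  C (a ^ 8 * c ^ 4) * (X 0 ^ 6 + X 1 ^ 6 + X 2 ^ 6) +
  C (a ^ 2 * c * (-(4 / 27) * a ^ 9 - (2 / 9) * a ^ 6 * c ^ 3 - (64 / 9) * a ^ 3 * c ^ 6 +
      (256 / 27) * c ^ 9)) * (X 0 ^ 3 * X 1 ^ 3 + X 0 ^ 3 * X 2 ^ 3 + X 1 ^ 3 * X 2 ^ 3) +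
  C (a ^ 4 * c ^ 2 * (-(2 / 3) * a ^ 6 + (16 / 3) * a ^ 3 * c ^ 3 - (32 / 3) * c ^ 6)) *
    (X 0 * X 1 * X 2 * (X 0 ^ 3 + X 1 ^ 3 + X 2 ^ 3)) +
  C (-(1 / 27) * a ^ 12 - (92 / 27) * a ^ 9 * c ^ 3 + (112 / 9) * a ^ 6 * c ^ 6 +
      (256 / 27) * a ^ 3 * c ^ 9 - (256 / 27) * c ^ 12) * (X 0 ^ 2 * X 1 ^ 2 * X 2 ^ 2)

/-- The linear form `x X + y Y + z Z`. -/
noncomputable def linearForm (x y z : ℂ) : MvPolynomial (Fin 3) ℂ :=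
  C x * X 0 + C y * X 1 + C z * X 2

lemma linearForm_isHomogeneous (x y z : ℂ) : (linearForm x y z).IsHomogeneous 1 :=
  ((isHomogeneous_C_mul_X x 0).add (isHomogeneous_C_mul_X y 1)).add (isHomogeneous_C_mul_X z 2)

lemma coeffs_eq_of_linearForm_eq_C_mul {x y z x' y' z' u : ℂ}
    (h : linearForm x y z = C u * linearForm x' y' z') :
    x = u * x' ∧ y = u * y' ∧ z = u * z' := by
  refine ⟨?_, ?_, ?_⟩
  · simpa [linearForm] using congrArg (eval ![1, 0, 0]) h
  · simpa [linearForm] using congrArg (eval ![0, 1, 0]) h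
  · simpa [linearForm] using congrArg (eval ![0, 0, 1]) h

lemma linearForm_ne_C_mul {x y z y' z' : ℂ} (hx : x ≠ 0) (hy : y ≠ y') (u : ℂ) :
    linearForm x y z ≠ C u * linearForm x y' z' := by
  intro h
  obtain ⟨h₁, h₂, -⟩ := coeffs_eq_of_linearForm_eq_C_mul h
  have hu : u = 1 := mul_right_cancel₀ hx (by rw [← h₁, one_mul])
  exact hy (by rw [h₂, hu, one_mul])

lemma IsPrimitiveRoot.one_add_self_add_sq_eq_zero {ω : ℂ} (hω : IsPrimitiveRoot ω 3) :
    1 + ω + ω ^ 2 = 0 := by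
  simpa [Finset.sum_range_succ] using hω.geom_sum_eq_zero (by norm_num)

/-- A member `X³ + Y³ + Z³ - 3vXYZ` of the Hesse pencil with `v³ = 1` is a triangle. -/
lemma linearForm_mul_eq_hesse {ω v : ℂ} (hω : IsPrimitiveRoot ω 3) (hv : v ^ 3 = 1) :
    linearForm v 1 1 * linearForm v ω (ω ^ 2) * linearForm v (ω ^ 2) ω =
      X 0 ^ 3 + X 1 ^ 3 + X 2 ^ 3 - 3 * C v * (X 0 * X 1 * X 2) := by
  have h₁ : (1 + C ω + C ω ^ 2 : MvPolynomial (Fin 3) ℂ) = 0 := by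
    simpa using congrArg (C (σ := Fin 3)) hω.one_add_self_add_sq_eq_zero
  have h₂ : (C v ^ 3 : MvPolynomial (Fin 3) ℂ) = 1 := by
    simpa using congrArg (C (σ := Fin 3)) hv
  simp only [linearForm, map_one, map_pow]
  generalize (C ω : MvPolynomial (Fin 3) ℂ) = w at *
  generalize (C v : MvPolynomial (Fin 3) ℂ) = t at *
  grind

/-- If the coefficients of the branch sextic are those of `lam · (X³ + Y³ + Z³ - 3vXYZ)²`
with `v³ = 1`, then the sextic is twice a triangle. -/
lemma branchSextic_double_triangle_of_coeffs {ω a c lam v : ℂ} (hω : IsPrimitiveRoot ω 3)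
    (hlam : lam ≠ 0) (hv : v ^ 3 = 1)
    (h₁ : a ^ 8 * c ^ 4 = lam)
    (h₂ : a ^ 2 * c * (-(4 / 27) * a ^ 9 - (2 / 9) * a ^ 6 * c ^ 3 - (64 / 9) * a ^ 3 * c ^ 6 +
      (256 / 27) * c ^ 9) = 2 * lam)
    (h₃ : a ^ 4 * c ^ 2 * (-(2 / 3) * a ^ 6 + (16 / 3) * a ^ 3 * c ^ 3 - (32 / 3) * c ^ 6) =
      -6 * (v * lam))
    (h₄ : -(1 / 27) * a ^ 12 - (92 / 27) * a ^ 9 * c ^ 3 + (112 / 9) * a ^ 6 * c ^ 6 +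
      (256 / 27) * a ^ 3 * c ^ 9 - (256 / 27) * c ^ 12 = 9 * (v ^ 2 * lam)) :
    ∃ lam : ℂ, lam ≠ 0 ∧ ∃ l₁ l₂ l₃ : MvPolynomial (Fin 3) ℂ,
      l₁.IsHomogeneous 1 ∧ l₂.IsHomogeneous 1 ∧ l₃.IsHomogeneous 1 ∧
      (∀ u : ℂ, l₁ ≠ C u * l₂ ∧ l₁ ≠ C u * l₃ ∧ l₂ ≠ C u * l₃) ∧
      branchSextic a c = C lam * (l₁ * l₂ * l₃) ^ 2 := by
  have hv₀ : v ≠ 0 := by rintro rfl; norm_num at hv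
  have hω₁ : ω ≠ 1 := hω.ne_one (by norm_num)
  have hω₂ : ω ^ 2 ≠ 1 := hω.pow_ne_one_of_pos_of_lt (by norm_num) (by norm_num)
  have hω₃ : ω ≠ ω ^ 2 := fun h ↦
    hω₁ (mul_left_cancel₀ (hω.ne_zero (by norm_num)) (by rw [← sq, ← h, mul_one]))
  refine ⟨lam, hlam, linearForm v 1 1, linearForm v ω (ω ^ 2), linearForm v (ω ^ 2) ω,
    linearForm_isHomogeneous .., linearForm_isHomogeneous .., linearForm_isHomogeneous ..,
    fun u ↦ ⟨linearForm_ne_C_mul hv₀ hω₁.symm u, linearForm_ne_C_mul hv₀ hω₂.symm u,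
      linearForm_ne_C_mul hv₀ hω₃ u⟩, ?_⟩
  rw [linearForm_mul_eq_hesse hω hv, branchSextic, h₁, h₂, h₃, h₄]
  simp only [map_mul, map_neg, map_pow, map_ofNat]
  ring

/-- If the branch sextic is a nonzero multiple of `X²Y²Z²`, then it is twice a triangle. -/
lemma branchSextic_double_triangle_of_eq_coordinate {a c lam : ℂ} (hlam : lam ≠ 0)
    (h : branchSextic a c = C lam * (X 0 * X 1 * X 2) ^ 2) :
    ∃ lam : ℂ, lam ≠ 0 ∧ ∃ l₁ l₂ l₃ : MvPolynomial (Fin 3) ℂ,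
      l₁.IsHomogeneous 1 ∧ l₂.IsHomogeneous 1 ∧ l₃.IsHomogeneous 1 ∧
      (∀ u : ℂ, l₁ ≠ C u * l₂ ∧ l₁ ≠ C u * l₃ ∧ l₂ ≠ C u * l₃) ∧
      branchSextic a c = C lam * (l₁ * l₂ * l₃) ^ 2 := by
  refine ⟨lam, hlam, linearForm 1 0 0, linearForm 0 1 0, linearForm 0 0 1,
    linearForm_isHomogeneous .., linearForm_isHomogeneous .., linearForm_isHomogeneous ..,
    fun u ↦ ⟨fun h ↦ ?_, fun h ↦ ?_, fun h ↦ ?_⟩, ?_⟩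
  · simpa using (coeffs_eq_of_linearForm_eq_C_mul h).1
  · simpa using (coeffs_eq_of_linearForm_eq_C_mul h).1
  · simpa using (coeffs_eq_of_linearForm_eq_C_mul h).2.1
  · simpa [linearForm] using h

/-- For `[a:c] ∈ T₁ ∪ T₂` (i.e. `a = 0`, `c = 0`, `a³ = c³` or `a³ = -8c³`), the branch
sextic `𝐁` is twice a triangle: `F_{a,c} = λ·(ℓ₁ℓ₂ℓ₃)²` with `λ ≠ 0` and `ℓ₁, ℓ₂, ℓ₃`
pairwise non-proportional linear forms. -/
theorem branchSextic_double_triangle (ω : ℂ) (hω : IsPrimitiveRoot ω 3) (a c : ℂ)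
    (hac : (a, c) ≠ (0, 0))
    (hdeg : a = 0 ∨ c = 0 ∨ a ^ 3 = c ^ 3 ∨ a ^ 3 = -8 * c ^ 3) :
    ∃ lam : ℂ, lam ≠ 0 ∧ ∃ l₁ l₂ l₃ : MvPolynomial (Fin 3) ℂ,
      l₁.IsHomogeneous 1 ∧ l₂.IsHomogeneous 1 ∧ l₃.IsHomogeneous 1 ∧
      (∀ u : ℂ, l₁ ≠ C u * l₂ ∧ l₁ ≠ C u * l₃ ∧ l₂ ≠ C u * l₃) ∧
      branchSextic a c = C lam * (l₁ * l₂ * l₃) ^ 2 := by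
  rcases eq_or_ne a 0 with rfl | ha
  · have hc : c ≠ 0 := by rintro rfl; exact hac rfl
    refine branchSextic_double_triangle_of_eq_coordinate (lam := -(256 / 27) * c ^ 12)
      (mul_ne_zero (by norm_num) (pow_ne_zero _ hc)) ?_
    simp [branchSextic, mul_pow]
  rcases eq_or_ne c 0 with rfl | hc
  · refine branchSextic_double_triangle_of_eq_coordinate (lam := -(1 / 27) * a ^ 12)
      (mul_ne_zero (by norm_num) (pow_ne_zero _ ha)) ?_
    simp [branchSextic, mul_pow]
  obtain ⟨u, rfl⟩ : ∃ u, a = u * c := ⟨a / c, by field_simp⟩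
  have hu : u ≠ 0 := left_ne_zero_of_mul ha
  have hc₃ : c ^ 3 ≠ 0 := pow_ne_zero _ hc
  rcases hdeg with h | h | h | h
  · exact absurd h ha
  · exact absurd h hc
  · have hu₃ : u ^ 3 = 1 := mul_right_cancel₀ hc₃ (by rw [← mul_pow, h, one_mul])
    refine branchSextic_double_triangle_of_coeffs (lam := u ^ 2 * c ^ 12) (v := u ^ 2) hω
      (by simp [hu, hc]) ?_ ?_ ?_ ?_ ?_ <;> grind
  · have hu₃ : u ^ 3 = -8 := mul_right_cancel₀ hc₃ (by rw [← mul_pow, h])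
    refine branchSextic_double_triangle_of_coeffs (lam := 64 * u ^ 2 * c ^ 12)
      (v := u ^ 2 / 4) hω (by simp [hu, hc]) ?_ ?_ ?_ ?_ ?_ <;> grind
end

section
/- Let a, c ∈ ℂ satisfy a ≠ 0, c ≠ 0, a³ ≠ c³ and a³ ≠ -8c³ (equivalently [a:c] ∉ T₁ ∪ T₂). Then the plane sextic defined by F_{a,c} has exactly nine singular points: the set of points [x:y:z] ∈ ℙ²(ℂ) at which all three partial derivatives ∂F_{a,c}/∂X, ∂F_{a,c}/∂Y, ∂F_{a,c}/∂Z vanish is finite of cardinality 9 (these are the nine ordinary cusps of the sextic 𝐁, the dual of a smooth member of the Hesse pencil). -/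
open MvPolynomial

open scoped LinearAlgebra.Projectivization

/-- A point of `ℙ²(ℂ)` is a singular point of the sextic `F_{a,c}` if all three partial
derivatives of `F_{a,c}` vanish there. -/
def singularLocus (a c : ℂ) : Set (ℙ ℂ (Fin 3 → ℂ)) :=
  {P | ∀ i : Fin 3, eval P.rep (pderiv i (branchSextic a c)) = 0}

/-- One sixth of the partial derivative in `x` of the dual sextic
`∑ x⁶ - (2 - 4p³) ∑ x³y³ - 6p² xyz ∑ x³ + (12p - 3p⁴) x²y²z²` of the Hesse cubic
`x³ + y³ + z³ - 3p xyz`. -/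
def dualSexticPartial (p x y z : ℂ) : ℂ :=
  x ^ 5 - (1 - 2 * p ^ 3) * x ^ 2 * (y ^ 3 + z ^ 3) - p ^ 2 * (y * z) * (4 * x ^ 3 + y ^ 3 + z ^ 3)
    + (4 * p - p ^ 4) * x * y ^ 2 * z ^ 2

/-- The parameter of the Hesse cubic whose dual is `F_{a,c}`. -/
noncomputable def hesseParameter (a c : ℂ) : ℂ := (4 * c ^ 3 - a ^ 3) / (3 * a ^ 2 * c)

theorem hesseParameter_pow_three_ne_one {a c : ℂ} (ha : a ≠ 0) (hc : c ≠ 0)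
    (h1 : a ^ 3 ≠ c ^ 3) (h2 : a ^ 3 ≠ -8 * c ^ 3) : hesseParameter a c ^ 3 ≠ 1 := by
  intro h
  rw [hesseParameter, div_pow, div_eq_one_iff_eq (by simp [ha, hc])] at h
  have key : (a ^ 3 - c ^ 3) * (a ^ 3 - -8 * c ^ 3) ^ 2 = 0 := by linear_combination -h
  exact mul_ne_zero (sub_ne_zero.2 h1) (pow_ne_zero 2 (sub_ne_zero.2 h2)) key

theorem eval_pderiv_branchSextic {a c : ℂ} (ha : a ≠ 0) (hc : c ≠ 0) (v : Fin 3 → ℂ) (i : Fin 3) :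
    eval v (pderiv i (branchSextic a c)) =
      6 * a ^ 8 * c ^ 4 * dualSexticPartial (hesseParameter a c) (v i) (v (i + 1)) (v (i + 2)) := by
  fin_cases i <;>
  · simp [branchSextic, dualSexticPartial, hesseParameter, pderiv_X,
      Derivation.leibniz_pow]
    field_simp
    ring

theorem dualSexticPartial_mul (p k x y z : ℂ) :
    dualSexticPartial p (k * x) (k * y) (k * z) = k ^ 5 * dualSexticPartial p x y z := by
  unfold dualSexticPartial; ring

theorem cube_sub_mul_eq_zero {p x y z : ℂ} (hx : dualSexticPartial p x y z = 0)
    (hy : dualSexticPartial p y z x = 0) :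
    (x ^ 3 - y ^ 3) * (x ^ 3 + y ^ 3 - (1 - 2 * p ^ 3) * z ^ 3 - 3 * p ^ 2 * (x * y * z)) = 0 := by
  unfold dualSexticPartial at hx hy
  linear_combination x * hx - y * hy

/-- A singular point of the dual sextic whose coordinates have equal cubes forces the Hesse
cubic to be singular. -/
theorem eq_zero_of_cubes_eq {p x y z : ℂ} (hp : p ^ 3 ≠ 1) (hxy : x ^ 3 = y ^ 3)
    (hyz : y ^ 3 = z ^ 3) (hx : dualSexticPartial p x y z = 0) : x = 0 := by
  by_contra h0
  have hw : (x * y * z) ^ 3 = (x ^ 3) ^ 3 := by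
    rw [mul_pow, mul_pow, ← hyz, ← hxy]; ring
  unfold dualSexticPartial at hx
  rw [← hyz, ← hxy] at hx
  have h4 : (p * (x * y * z) ^ 2 - x ^ 6) ^ 4 = 0 := by
    generalize hwd : x * y * z = w at *
    have e : x ^ 6 - 2 * (1 - 2 * p ^ 3) * x ^ 6 - 6 * p ^ 2 * w * x ^ 3
        + (4 * p - p ^ 4) * w ^ 2 = 0 := by
      rw [← hwd]; linear_combination x * hx
    have e6 : w ^ 6 = x ^ 18 := by linear_combination (w ^ 3 + x ^ 9) * hw
    have e8 : w ^ 8 = x ^ 18 * w ^ 2 := by linear_combination w ^ 2 * e6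
    have e4 : w ^ 4 = x ^ 9 * w := by linear_combination w * hw
    linear_combination p ^ 4 * e8 - 4 * p ^ 3 * x ^ 6 * e6 + 6 * p ^ 2 * x ^ 12 * e4 - x ^ 18 * e
  have h5 : p * (x * y * z) ^ 2 = x ^ 6 := sub_eq_zero.1 (pow_eq_zero_iff (by norm_num) |>.1 h4)
  apply hp
  have h6 : p ^ 3 * x ^ 18 = 1 * x ^ 18 := by
    calc p ^ 3 * x ^ 18 = p ^ 3 * ((x ^ 3) ^ 3) ^ 2 := by ring
      _ = (p * (x * y * z) ^ 2) ^ 3 := by rw [← hw]; ring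
      _ = 1 * x ^ 18 := by rw [h5]; ring
  exact mul_right_cancel₀ (pow_ne_zero _ h0) h6

theorem exists_cusp_of_cubes_eq {p x y z : ℂ} (hp : p ^ 3 ≠ 1) (hxy : x ^ 3 = y ^ 3)
    (hyz : y ^ 3 ≠ z ^ 3) (hy : dualSexticPartial p y z x = 0)
    (hz : dualSexticPartial p z x y = 0) :
    ∃ k ε : ℂ, ε ^ 3 = 1 ∧ z = k * p ∧ x = k * ε ∧ y = k * ε ^ 2 := by
  have h := (mul_eq_zero.1 (cube_sub_mul_eq_zero hy hz)).resolve_left (sub_ne_zero.2 hyz)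
  have hx0 : x ≠ 0 := by
    rintro rfl
    have hy0 : y = 0 := by simpa using hxy.symm
    subst hy0
    apply hyz
    linear_combination -h
  obtain ⟨ε, rfl⟩ : ∃ ε, y = ε * x := ⟨y / x, by field_simp⟩
  have hε : ε ^ 3 = 1 := by
    apply mul_right_cancel₀ (pow_ne_zero 3 hx0)
    linear_combination -hxy
  have hε0 : ε ≠ 0 := by rintro rfl; norm_num at hε
  obtain ⟨v, rfl⟩ : ∃ v, z = ε ^ 2 * v := ⟨ε * z, by linear_combination -z * hε⟩
  have e6 : ε ^ 6 = 1 := by linear_combination (ε ^ 3 + 1) * hε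
  have hfac : (v - p * x) ^ 2 * (v + 2 * p * x) = 0 := by
    linear_combination h - v ^ 3 * e6 + (3 * p ^ 2 * x ^ 2 * v - x ^ 3) * hε
  have hv : v = p * x := by
    rcases mul_eq_zero.1 hfac with h' | h'
    · exact sub_eq_zero.1 (pow_eq_zero_iff (by norm_num) |>.1 h')
    · obtain rfl : v = -2 * p * x := by linear_combination h'
      suffices p = 0 by simp [this]
      have e4 : ε ^ 4 = ε := by linear_combination ε * hε
      have e7 : ε ^ 7 = ε := by linear_combination ε * e6
      have e10 : ε ^ 10 = ε := by linear_combination ε ^ 4 * e6 + e4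
      unfold dualSexticPartial at hz
      have key : 18 * p ^ 2 * (p ^ 3 - 1) * (ε * x ^ 5) = 0 := by
        linear_combination hz - x ^ 5 * (-32 * p ^ 5 * e10 - (1 - 2 * p ^ 3) * 4 * p ^ 2 * (e4 + e7)
          - p ^ 2 * (-32 * p ^ 3 * e7 + e4) - 2 * p * (4 * p - p ^ 4) * e4)
      simpa [sub_ne_zero.2 hp, hε0, hx0] using key
  exact ⟨ε ^ 2 * x, ε, hε, by rw [hv]; ring, by linear_combination -x * hε,
    by linear_combination -ε * x * hε⟩

/-- The vector with entries `p, ε, ε²`, starting from position `i` cyclically. -/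
def cuspVector (p : ℂ) (i : Fin 3) (ε : ℂ) : Fin 3 → ℂ := fun j => ![p, ε, ε ^ 2] (j - i)

theorem cuspVector_ne_zero (p : ℂ) (i : Fin 3) {ε : ℂ} (hε : ε ≠ 0) : cuspVector p i ε ≠ 0 := by
  intro h
  have := congrFun h (i + 1)
  simp [cuspVector, hε] at this

theorem cuspVector_pow_three (p : ℂ) (i j : Fin 3) {ε : ℂ} (hε : ε ^ 3 = 1) :
    cuspVector p i ε j ^ 3 = if j = i then p ^ 3 else 1 := by
  have hε2 : (ε ^ 2) ^ 3 = 1 := by rw [← pow_mul, mul_comm, pow_mul, hε, one_pow]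
  obtain ⟨l, rfl⟩ : ∃ l, j = l + i := ⟨j - i, by simp⟩
  fin_cases l <;> simp [cuspVector, hε, hε2]

theorem dualSexticPartial_cuspVector (p : ℂ) (i j : Fin 3) {ε : ℂ} (hε : ε ^ 3 = 1) :
    dualSexticPartial p (cuspVector p i ε j) (cuspVector p i ε (j + 1))
      (cuspVector p i ε (j + 2)) = 0 := by
  obtain ⟨l, rfl⟩ : ∃ l, j = l + i := ⟨j - i, by simp⟩
  have e1 : l + i + 1 - i = l + 1 := by abel
  have e2 : l + i + 2 - i = l + 2 := by abel
  simp only [cuspVector, e1, e2, add_sub_cancel_right]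
  have e6 : ε ^ 6 = 1 := by linear_combination (ε ^ 3 + 1) * hε
  have e9 : ε ^ 9 = 1 := by linear_combination ε ^ 3 * e6 + hε
  unfold dualSexticPartial
  fin_cases l
  · change p ^ 5 - (1 - 2 * p ^ 3) * p ^ 2 * (ε ^ 3 + (ε ^ 2) ^ 3)
      - p ^ 2 * (ε * ε ^ 2) * (4 * p ^ 3 + ε ^ 3 + (ε ^ 2) ^ 3)
      + (4 * p - p ^ 4) * p * ε ^ 2 * (ε ^ 2) ^ 2 = 0
    linear_combination -(1 - 2 * p ^ 3) * p ^ 2 * (hε + e6) - p ^ 2 * (4 * p ^ 3 * hε + e6 + e9)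
      + (4 * p - p ^ 4) * p * e6
  · change ε ^ 5 - (1 - 2 * p ^ 3) * ε ^ 2 * ((ε ^ 2) ^ 3 + p ^ 3)
      - p ^ 2 * (ε ^ 2 * p) * (4 * ε ^ 3 + (ε ^ 2) ^ 3 + p ^ 3)
      + (4 * p - p ^ 4) * ε * (ε ^ 2) ^ 2 * p ^ 2 = 0
    linear_combination ε ^ 2 * (hε - (1 - 2 * p ^ 3) * e6 - p ^ 3 * (4 * hε + e6)
      + (4 * p ^ 3 - p ^ 6) * hε)
  · change (ε ^ 2) ^ 5 - (1 - 2 * p ^ 3) * (ε ^ 2) ^ 2 * (p ^ 3 + ε ^ 3)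
      - p ^ 2 * (p * ε) * (4 * (ε ^ 2) ^ 3 + p ^ 3 + ε ^ 3)
      + (4 * p - p ^ 4) * ε ^ 2 * p ^ 2 * ε ^ 2 = 0
    linear_combination ε * (e9 - (1 - 2 * p ^ 3) * (p ^ 3 * hε + e6) - p ^ 3 * (4 * e6 + hε)
      + (4 * p ^ 3 - p ^ 6) * hε)

theorem exists_eq_cuspVector {p : ℂ} (hp : p ^ 3 ≠ 1) {v : Fin 3 → ℂ} (hv : v ≠ 0)
    (h : ∀ i, dualSexticPartial p (v i) (v (i + 1)) (v (i + 2)) = 0) :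
    ∃ (i : Fin 3) (k ε : ℂ), ε ^ 3 = 1 ∧ v = k • cuspVector p i ε := by
  have h0 : dualSexticPartial p (v 0) (v 1) (v 2) = 0 := h 0
  have h1 : dualSexticPartial p (v 1) (v 2) (v 0) = 0 := h 1
  have h2 : dualSexticPartial p (v 2) (v 0) (v 1) = 0 := h 2
  have of_cubes_eq (i : Fin 3) (e : v (i + 1) ^ 3 = v (i + 2) ^ 3) (ne : v (i + 2) ^ 3 ≠ v i ^ 3) :
      ∃ (i : Fin 3) (k ε : ℂ), ε ^ 3 = 1 ∧ v = k • cuspVector p i ε := by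
    have hi := h (i + 2)
    rw [show i + 2 + 1 = i by fin_cases i <;> rfl, show i + 2 + 2 = i + 1 by fin_cases i <;> rfl]
      at hi
    obtain ⟨k, ε, hε, ez, ex, ey⟩ := exists_cusp_of_cubes_eq hp e ne hi (h i)
    refine ⟨i, k, ε, hε, funext fun j => ?_⟩
    obtain ⟨l, rfl⟩ : ∃ l, j = i + l := ⟨j - i, by simp⟩
    fin_cases l <;> simp [cuspVector, ez, ex, ey]
  by_cases a01 : v 0 ^ 3 = v 1 ^ 3
  · by_cases a12 : v 1 ^ 3 = v 2 ^ 3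
    · have z0 := eq_zero_of_cubes_eq hp a01 a12 h0
      refine absurd (funext fun j => ?_) hv
      rw [z0] at a01
      have z1 : v 1 = 0 := by simpa using a01.symm
      rw [z1] at a12
      have z2 : v 2 = 0 := by simpa using a12.symm
      fin_cases j <;> assumption
    · exact of_cubes_eq 2 a01 a12
  · by_cases a12 : v 1 ^ 3 = v 2 ^ 3
    · exact of_cubes_eq 0 a12 fun e => a01 (e.symm.trans a12.symm)
    · by_cases a20 : v 2 ^ 3 = v 0 ^ 3
      · exact of_cubes_eq 1 a20 a01
      · have k01 := (mul_eq_zero.1 (cube_sub_mul_eq_zero h0 h1)).resolve_left (sub_ne_zero.2 a01)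
        have k12 := (mul_eq_zero.1 (cube_sub_mul_eq_zero h1 h2)).resolve_left (sub_ne_zero.2 a12)
        have e : (v 2 ^ 3 - v 0 ^ 3) * (1 - p ^ 3) = 0 := by linear_combination (k12 - k01) / 2
        exact absurd (sub_eq_zero.1 ((mul_eq_zero.1 e).resolve_left (sub_ne_zero.2 a20))).symm hp

theorem eq_of_smul_cuspVector_eq {p : ℂ} (hp : p ^ 3 ≠ 1) {i j : Fin 3} {ε δ k : ℂ}
    (hε : ε ^ 3 = 1) (hδ : δ ^ 3 = 1) (h : k • cuspVector p j δ = cuspVector p i ε) :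
    i = j ∧ ε = δ := by
  have hε0 : ε ≠ 0 := by rintro rfl; norm_num at hε
  have hcube (l : Fin 3) := congrArg (· ^ 3) (congrFun h l)
  simp only [Pi.smul_apply, smul_eq_mul, mul_pow, cuspVector_pow_three p _ _ hε,
    cuspVector_pow_three p _ _ hδ] at hcube
  have hij : i = j := by
    by_contra hne
    obtain ⟨l, hli, hlj⟩ : ∃ l, l ≠ i ∧ l ≠ j :=
      (by decide : ∀ i j : Fin 3, ∃ l, l ≠ i ∧ l ≠ j) i j
    have hk : k ^ 3 = 1 := by simpa [hli, hlj] using hcube l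
    exact hp (by simpa [hne, hk] using (hcube i).symm)
  subst hij
  refine ⟨rfl, ?_⟩
  have c1 : k * δ = ε := by simpa [cuspVector] using congrFun h (i + 1)
  have c2 : k * δ ^ 2 = ε ^ 2 := by simpa [cuspVector] using congrFun h (i + 2)
  have : ε * δ = ε * ε := by rw [← pow_two ε, ← c2, ← c1]; ring
  exact (mul_left_cancel₀ hε0 this).symm

/-- The cusps of the dual of the Hesse cubic with parameter `p`. -/
noncomputable def cusp (p : ℂ) (q : Fin 3 × rootsOfUnity 3 ℂ) : ℙ ℂ (Fin 3 → ℂ) :=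
  Projectivization.mk ℂ (cuspVector p q.1 (q.2 : ℂˣ)) (cuspVector_ne_zero p q.1 (Units.ne_zero _))

theorem cube_eq_one_of_rootsOfUnity (ε : rootsOfUnity 3 ℂ) : ((ε : ℂˣ) : ℂ) ^ 3 = 1 :=
  (mem_rootsOfUnity' 3 _).1 ε.2

theorem cusp_injective {p : ℂ} (hp : p ^ 3 ≠ 1) : Function.Injective (cusp p) := by
  rintro ⟨i, ε⟩ ⟨j, δ⟩ h
  obtain ⟨k, hk⟩ := (Projectivization.mk_eq_mk_iff' ..).1 h
  obtain ⟨rfl, e⟩ := eq_of_smul_cuspVector_eq hp (cube_eq_one_of_rootsOfUnity ε)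
    (cube_eq_one_of_rootsOfUnity δ) hk
  rw [Subtype.ext (Units.ext e)]

theorem singularLocus_eq_range_cusp {a c : ℂ} (ha : a ≠ 0) (hc : c ≠ 0)
    (hp : hesseParameter a c ^ 3 ≠ 1) :
    singularLocus a c = Set.range (cusp (hesseParameter a c)) := by
  have mem_iff (P : ℙ ℂ (Fin 3 → ℂ)) : P ∈ singularLocus a c ↔
      ∀ i, dualSexticPartial (hesseParameter a c) (P.rep i) (P.rep (i + 1)) (P.rep (i + 2)) = 0 := by
    simp [singularLocus, eval_pderiv_branchSextic ha hc, ha, hc]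
  ext P
  rw [mem_iff]
  constructor
  · intro h
    obtain ⟨i, k, ε, hε, hv⟩ := exists_eq_cuspVector hp P.rep_nonzero h
    refine ⟨(i, rootsOfUnity.mkOfPowEq ε hε), ?_⟩
    rw [← P.mk_rep]
    refine ((Projectivization.mk_eq_mk_iff' ..).2 ⟨k, ?_⟩).symm
    simpa using hv.symm
  · rintro ⟨⟨i, ε⟩, rfl⟩ j
    obtain ⟨k, hk⟩ := Projectivization.exists_smul_eq_mk_rep ℂ
      (cuspVector (hesseParameter a c) i (ε : ℂˣ)) (cuspVector_ne_zero _ i (Units.ne_zero _))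
    rw [cusp, ← hk]
    simp only [Pi.smul_apply, Units.smul_def, smul_eq_mul]
    rw [dualSexticPartial_mul,
      dualSexticPartial_cuspVector _ _ _ (cube_eq_one_of_rootsOfUnity ε), mul_zero]

/-- For `[a:c] ∉ T₁ ∪ T₂` the plane sextic `F_{a,c}` has exactly nine singular points:
the nine ordinary cusps of the dual of a smooth member of the Hesse pencil. -/
theorem branchSextic_nine_singular_points (a c : ℂ)
    (ha : a ≠ 0) (hc : c ≠ 0) (h1 : a ^ 3 ≠ c ^ 3) (h2 : a ^ 3 ≠ -8 * c ^ 3) :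
    (singularLocus a c).Finite ∧ (singularLocus a c).ncard = 9 := by
  have hp := hesseParameter_pow_three_ne_one ha hc h1 h2
  rw [singularLocus_eq_range_cusp ha hc hp]
  refine ⟨Set.finite_range _, ?_⟩
  rw [← Set.image_univ, Set.ncard_image_of_injective _ (cusp_injective hp), Set.ncard_univ,
    Nat.card_prod, Complex.card_rootsOfUnity,
    Nat.card_fin]
end

section
/- Let a, c ∈ ℂ satisfy a ≠ 0, c ≠ 0, a³ ≠ c³ and a³ ≠ -8c³. Then the ℂ-vector space of homogeneous cubic polynomials G ∈ ℂ[X,Y,Z] vanishing at every singular point of the sextic F_{a,c} is one-dimensional; i.e., up to a nonzero scalar there is a unique plane cubic passing through the nine cusps of 𝐁. -/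
open MvPolynomial

open scoped LinearAlgebra.Projectivization

/-- The space of homogeneous cubics vanishing at every singular point of `F_{a,c}`. -/
noncomputable def cubicsThroughCusps (a c : ℂ) : Submodule ℂ (MvPolynomial (Fin 3) ℂ) :=
  homogeneousSubmodule (Fin 3) ℂ 3 ⊓
    ⨅ P ∈ singularLocus a c,
      LinearMap.ker (aeval (R := ℂ) (P.rep : Fin 3 → ℂ)).toLinearMap

/-- The dual of the Hesse cubic `X³ + Y³ + Z³ - 3sXYZ`. -/
noncomputable def dualHesseSextic (s : ℂ) : MvPolynomial (Fin 3) ℂ :=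
  X 0 ^ 6 + X 1 ^ 6 + X 2 ^ 6 +
  C (4 * s ^ 3 - 2) * (X 0 ^ 3 * X 1 ^ 3 + X 0 ^ 3 * X 2 ^ 3 + X 1 ^ 3 * X 2 ^ 3) -
  C (6 * s ^ 2) * (X 0 * X 1 * X 2 * (X 0 ^ 3 + X 1 ^ 3 + X 2 ^ 3)) +
  C (12 * s - 3 * s ^ 4) * (X 0 ^ 2 * X 1 ^ 2 * X 2 ^ 2)

/-- The first partial derivative of the dual Hesse sextic, as a function; the other two are
obtained by permuting the variables. -/
def dualHessePartial (s x y z : ℂ) : ℂ :=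
  6 * x ^ 5 + (12 * s ^ 3 - 6) * x ^ 2 * (y ^ 3 + z ^ 3) -
    6 * s ^ 2 * (y * z) * (4 * x ^ 3 + y ^ 3 + z ^ 3) +
    (24 * s - 6 * s ^ 4) * x * (y * z) ^ 2

/-- The member of the Hesse pencil through the point `[s : 1 : 1]`. -/
noncomputable def hesseCubicThrough (s : ℂ) : MvPolynomial (Fin 3) ℂ :=
  C s * (X 0 ^ 3 + X 1 ^ 3 + X 2 ^ 3) - C (s ^ 3 + 2) * (X 0 * X 1 * X 2)

lemma branchSextic_eq_smul_dualHesseSextic {a c : ℂ} (ha : a ≠ 0) (hc : c ≠ 0) :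
    branchSextic a c =
      C (a ^ 8 * c ^ 4) * dualHesseSextic ((4 * c ^ 3 - a ^ 3) / (3 * a ^ 2 * c)) := by
  set s := (4 * c ^ 3 - a ^ 3) / (3 * a ^ 2 * c) with hs
  have hB : a ^ 2 * c * (-(4 / 27) * a ^ 9 - (2 / 9) * a ^ 6 * c ^ 3 -
      (64 / 9) * a ^ 3 * c ^ 6 + (256 / 27) * c ^ 9) = a ^ 8 * c ^ 4 * (4 * s ^ 3 - 2) := by
    rw [hs]; field_simp; ring
  have hC : a ^ 4 * c ^ 2 * (-(2 / 3) * a ^ 6 + (16 / 3) * a ^ 3 * c ^ 3 - (32 / 3) * c ^ 6) =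
      -(a ^ 8 * c ^ 4 * (6 * s ^ 2)) := by
    rw [hs]; field_simp; ring
  have hD : -(1 / 27) * a ^ 12 - (92 / 27) * a ^ 9 * c ^ 3 + (112 / 9) * a ^ 6 * c ^ 6 +
      (256 / 27) * a ^ 3 * c ^ 9 - (256 / 27) * c ^ 12 =
      a ^ 8 * c ^ 4 * (12 * s - 3 * s ^ 4) := by
    rw [hs]; field_simp; ring
  rw [branchSextic, hB, hC, hD, dualHesseSextic]
  simp only [map_mul, map_neg]
  ring

lemma eval_pderiv_dualHesseSextic (s : ℂ) (v : Fin 3 → ℂ) :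
    eval v (pderiv 0 (dualHesseSextic s)) = dualHessePartial s (v 0) (v 1) (v 2) ∧
    eval v (pderiv 1 (dualHesseSextic s)) = dualHessePartial s (v 1) (v 2) (v 0) ∧
    eval v (pderiv 2 (dualHesseSextic s)) = dualHessePartial s (v 2) (v 0) (v 1) := by
  refine ⟨?_, ?_, ?_⟩ <;>
  · simp [dualHesseSextic, dualHessePartial, pderiv_X, Derivation.leibniz, Derivation.leibniz_pow]
    ring

lemma mem_singularLocus_iff {a c : ℂ} (ha : a ≠ 0) (hc : c ≠ 0) (P : ℙ ℂ (Fin 3 → ℂ)) :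
    P ∈ singularLocus a c ↔
      dualHessePartial ((4 * c ^ 3 - a ^ 3) / (3 * a ^ 2 * c)) (P.rep 0) (P.rep 1) (P.rep 2) = 0 ∧
      dualHessePartial ((4 * c ^ 3 - a ^ 3) / (3 * a ^ 2 * c)) (P.rep 1) (P.rep 2) (P.rep 0) = 0 ∧
      dualHessePartial ((4 * c ^ 3 - a ^ 3) / (3 * a ^ 2 * c)) (P.rep 2) (P.rep 0) (P.rep 1) = 0 := by
  obtain ⟨h0, h1, h2⟩ :=
    eval_pderiv_dualHesseSextic ((4 * c ^ 3 - a ^ 3) / (3 * a ^ 2 * c)) P.rep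
  rw [← h0, ← h1, ← h2]
  simp [singularLocus, branchSextic_eq_smul_dualHesseSextic ha hc, Fin.forall_fin_succ, ha, hc]

/-- With `p = x³`, `q = y³`, `r = z³` and `m = xyz`, this is `x / 6` times the first partial
derivative of the dual Hesse sextic. -/
def dualHesseQuadratic (s S m p : ℂ) : ℂ :=
  2 * (1 - s ^ 3) * p ^ 2 + ((2 * s ^ 3 - 1) * S - 3 * s ^ 2 * m) * p - s ^ 2 * m * S +
    (4 * s - s ^ 4) * m ^ 2

lemma eq_of_dualHesseQuadratic_eq_zero {s p r m : ℂ} (hs : s ^ 3 ≠ 1) (hm : m ^ 3 = p * p * r)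
    (hp : dualHesseQuadratic s (p + p + r) m p = 0)
    (hr : dualHesseQuadratic s (p + p + r) m r = 0) :
    s * (p + p + r) = (s ^ 3 + 2) * m := by
  unfold dualHesseQuadratic at hp hr
  rcases eq_or_ne p 0 with rfl | hp0
  · obtain rfl : m = 0 := by simpa using hm
    have hr0 : r ^ 2 = 0 := by linear_combination hr
    obtain rfl : r = 0 := by simpa using hr0
    simp
  obtain ⟨n, rfl⟩ : ∃ n, m = p * n := ⟨m / p, by field_simp⟩
  obtain rfl : r = p * n ^ 3 := by
    refine mul_left_cancel₀ (mul_ne_zero hp0 hp0) ?_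
    linear_combination -hm
  have hp' : 2 * s ^ 3 + (2 * s ^ 3 - 1) * n ^ 3 - 5 * s ^ 2 * n - s ^ 2 * n ^ 4 +
      (4 * s - s ^ 4) * n ^ 2 = 0 := by
    refine mul_left_cancel₀ (pow_ne_zero 2 hp0) ?_
    linear_combination hp
  have hd : (n ^ 3 - 1) * ((n - s) ^ 2 * (n + 2 * s)) = 0 := by
    refine mul_left_cancel₀ (pow_ne_zero 2 hp0) ?_
    linear_combination hr - hp
  have hn : n = s := by
    rcases mul_eq_zero.mp hd with h | h
    · have h4 : (s * n ^ 2 - 1) ^ 4 = 0 := by grind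
      have h' : s * n ^ 2 = 1 := by
        simpa [sub_eq_zero] using h4
      exact absurd (by grind) hs
    · rcases mul_eq_zero.mp h with h | h
      · simpa [sub_eq_zero] using h
      · obtain rfl : n = -2 * s := by linear_combination h
        have h' : s ^ 3 * (1 - s ^ 3) = 0 := by linear_combination hp' / 36
        rcases mul_eq_zero.mp h' with h' | h'
        · obtain rfl : s = 0 := by simpa using h'
          simp
        · exact absurd (by linear_combination -h') hs
  rw [hn]
  ring

lemma hesseCubic_eq_zero_of_dualHessePartial_eq_zero {s x y z : ℂ} (hs : s ^ 3 ≠ 1)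
    (hx : dualHessePartial s x y z = 0) (hy : dualHessePartial s y z x = 0)
    (hz : dualHessePartial s z x y = 0) :
    s * (x ^ 3 + y ^ 3 + z ^ 3) = (s ^ 3 + 2) * (x * y * z) := by
  unfold dualHessePartial at hx hy hz
  have hp : dualHesseQuadratic s (x ^ 3 + y ^ 3 + z ^ 3) (x * y * z) (x ^ 3) = 0 := by
    unfold dualHesseQuadratic; linear_combination x / 6 * hx
  have hq : dualHesseQuadratic s (x ^ 3 + y ^ 3 + z ^ 3) (x * y * z) (y ^ 3) = 0 := by
    unfold dualHesseQuadratic; linear_combination y / 6 * hy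
  have hr : dualHesseQuadratic s (x ^ 3 + y ^ 3 + z ^ 3) (x * y * z) (z ^ 3) = 0 := by
    unfold dualHesseQuadratic; linear_combination z / 6 * hz
  have hm : (x * y * z) ^ 3 = x ^ 3 * y ^ 3 * z ^ 3 := by ring
  generalize x ^ 3 = p at *
  generalize y ^ 3 = q at *
  generalize z ^ 3 = r at *
  generalize x * y * z = m at *
  by_cases hpq : p = q
  · subst hpq
    exact eq_of_dualHesseQuadratic_eq_zero hs hm hp hr
  by_cases hpr : p = r
  · subst hpr
    have hS : p + q + p = p + p + q := by ring
    rw [hS] at hp hq ⊢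
    exact eq_of_dualHesseQuadratic_eq_zero hs (by linear_combination hm) hp hq
  have hqr : q = r := by
    unfold dualHesseQuadratic at hp hq hr
    have h1 : 2 * (1 - s ^ 3) * (p + q) + ((2 * s ^ 3 - 1) * (p + q + r) - 3 * s ^ 2 * m) = 0 :=
      mul_left_cancel₀ (sub_ne_zero.mpr hpq) (by linear_combination hp - hq)
    have h2 : 2 * (1 - s ^ 3) * (p + r) + ((2 * s ^ 3 - 1) * (p + q + r) - 3 * s ^ 2 * m) = 0 :=
      mul_left_cancel₀ (sub_ne_zero.mpr hpr) (by linear_combination hp - hr)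
    refine mul_left_cancel₀ (sub_ne_zero.mpr hs) ?_
    linear_combination -(h1 - h2) / 2
  subst hqr
  have hS : p + q + q = q + q + p := by ring
  rw [hS] at hp hq ⊢
  exact eq_of_dualHesseQuadratic_eq_zero hs (by linear_combination hm) hq hp

/-- A ternary cubic form with explicit coefficients, grouped by their weight under the action of
`diag(1, ω, ω²)`. -/
noncomputable def ternaryCubic (e : Fin 10 → ℂ) : MvPolynomial (Fin 3) ℂ :=
  C (e 0) * X 0 ^ 3 + C (e 1) * X 1 ^ 3 + C (e 2) * X 2 ^ 3 + C (e 3) * (X 0 * X 1 * X 2) +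
  C (e 4) * (X 0 ^ 2 * X 1) + C (e 5) * (X 1 ^ 2 * X 2) + C (e 6) * (X 2 ^ 2 * X 0) +
  C (e 7) * (X 0 ^ 2 * X 2) + C (e 8) * (X 1 ^ 2 * X 0) + C (e 9) * (X 2 ^ 2 * X 1)

lemma MvPolynomial.IsHomogeneous.exists_eq_ternaryCubic {H : MvPolynomial (Fin 3) ℂ}
    (hH : H.IsHomogeneous 3) : ∃ e, H = ternaryCubic e := by
  have key : ∀ s : Finset (Fin 3 →₀ ℕ), (∀ d ∈ s, d.degree = 3) →
      ∃ e, ∑ d ∈ s, monomial d (coeff d H) = ternaryCubic e := by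
    intro s
    induction s using Finset.induction_on with
    | empty => exact fun _ => ⟨0, by simp [ternaryCubic]⟩
    | insert d s hd ih =>
      intro h
      obtain ⟨e, he⟩ := ih fun d' hd' => h d' (Finset.mem_insert_of_mem hd')
      have hdeg : d 0 + d 1 + d 2 = 3 := by
        have := h d (Finset.mem_insert_self d s)
        rwa [Finsupp.degree_eq_sum, Fin.sum_univ_three] at this
      obtain ⟨i, hi⟩ : ∃ i, monomial d (coeff d H) = ternaryCubic (Pi.single i (coeff d H)) := by
        rw [monomial_eq, Finsupp.prod_fintype _ _ (by simp), Fin.prod_univ_three]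
        generalize coeff d H = b
        have h0 : d 0 ≤ 3 := by omega
        have h1 : d 1 ≤ 3 := by omega
        have h2 : d 2 = 3 - d 0 - d 1 := by omega
        rw [h2]
        generalize d 0 = i at *
        generalize d 1 = j at *
        generalize d 2 = k at *
        have hij : i + j ≤ 3 := by omega
        clear hdeg h2
        interval_cases i <;> interval_cases j <;> try omega
        · exact ⟨2, by simp [ternaryCubic]⟩
        · exact ⟨9, by simp [ternaryCubic, mul_comm]⟩
        · exact ⟨5, by simp [ternaryCubic]⟩
        · exact ⟨1, by simp [ternaryCubic]⟩
        · exact ⟨6, by simp [ternaryCubic, mul_comm]⟩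
        · exact ⟨3, by simp [ternaryCubic]⟩
        · exact ⟨8, by simp [ternaryCubic, mul_comm]⟩
        · exact ⟨7, by simp [ternaryCubic]⟩
        · exact ⟨4, by simp [ternaryCubic]⟩
        · exact ⟨0, by simp [ternaryCubic]⟩
      refine ⟨Pi.single i (coeff d H) + e, ?_⟩
      rw [Finset.sum_insert hd, hi, he]
      simp only [ternaryCubic, Pi.add_apply, map_add]
      ring
  obtain ⟨e, he⟩ := key H.support fun d hd => by
    rw [Finsupp.degree_eq_weight_one]
    exact hH (mem_support_iff.mp hd)
  exact ⟨e, by rw [← he, support_sum_monomial_coeff]⟩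

lemma eval_ternaryCubic_smul (e : Fin 10 → ℂ) (u : ℂ) (v : Fin 3 → ℂ) :
    eval (u • v) (ternaryCubic e) = u ^ 3 * eval v (ternaryCubic e) := by
  simp [ternaryCubic]
  ring

lemma dualHessePartial_mul (s u x y z : ℂ) :
    dualHessePartial s (u * x) (u * y) (u * z) = u ^ 5 * dualHessePartial s x y z := by
  unfold dualHessePartial
  ring

lemma mem_cubicsThroughCusps_iff {a c : ℂ} {H : MvPolynomial (Fin 3) ℂ} :
    H ∈ cubicsThroughCusps a c ↔
      H.IsHomogeneous 3 ∧ ∀ P ∈ singularLocus a c, eval P.rep H = 0 := by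
  simp [cubicsThroughCusps, Submodule.mem_iInf, aeval_eq_eval]

lemma eval_eq_zero_of_mem_cubicsThroughCusps {a c : ℂ} (ha : a ≠ 0) (hc : c ≠ 0)
    {e : Fin 10 → ℂ} (he : ternaryCubic e ∈ cubicsThroughCusps a c) {v : Fin 3 → ℂ} (hv : v ≠ 0)
    (h0 : dualHessePartial ((4 * c ^ 3 - a ^ 3) / (3 * a ^ 2 * c)) (v 0) (v 1) (v 2) = 0)
    (h1 : dualHessePartial ((4 * c ^ 3 - a ^ 3) / (3 * a ^ 2 * c)) (v 1) (v 2) (v 0) = 0)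
    (h2 : dualHessePartial ((4 * c ^ 3 - a ^ 3) / (3 * a ^ 2 * c)) (v 2) (v 0) (v 1) = 0) :
    eval v (ternaryCubic e) = 0 := by
  obtain ⟨u, hu⟩ := Projectivization.exists_smul_eq_mk_rep ℂ v hv
  have hu' : (Projectivization.mk ℂ v hv).rep = (u : ℂ) • v := hu.symm
  have h := (mem_cubicsThroughCusps_iff.mp he).2 (Projectivization.mk ℂ v hv) <| by
    rw [mem_singularLocus_iff ha hc, hu']
    simp [dualHessePartial_mul, h0, h1, h2]
  rw [hu', eval_ternaryCubic_smul] at h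
  simpa using h

/-- A circulant system with determinant `(s³ - 1)²`. -/
lemma eq_zero_of_circulant {s b c d : ℂ} (hs : s ^ 3 ≠ 1)
    (h0 : s ^ 2 * b + c + s * d = 0) (h1 : s * b + s ^ 2 * c + d = 0)
    (h2 : b + s * c + s ^ 2 * d = 0) : b = 0 ∧ c = 0 ∧ d = 0 := by
  have hs' := sub_ne_zero.mpr hs
  refine ⟨mul_left_cancel₀ hs' ?_, mul_left_cancel₀ hs' ?_, mul_left_cancel₀ hs' ?_⟩
  · linear_combination s * h0 - h2
  · linear_combination s * h1 - h0
  · linear_combination s * h2 - h1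

/-- Splitting into eigencomponents of an automorphism of order three. -/
lemma eq_zero_of_weights {p q r : ℂ} (h : ∀ t : ℂ, t ^ 3 = 1 → p + t * q + t ^ 2 * r = 0) :
    p = 0 ∧ q = 0 ∧ r = 0 := by
  obtain ⟨w, hw⟩ : ∃ w : ℂ, w ^ 2 + w + 1 = 0 := by
    have h := (Complex.isPrimitiveRoot_exp 3 (by norm_num)).geom_sum_eq_zero (by norm_num)
    exact ⟨_, by rw [← h]; simp only [Finset.sum_range_succ, Finset.sum_range_zero]; ring⟩
  have hw3 : w ^ 3 = 1 := by linear_combination (w - 1) * hw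
  have h0 := h 1 (by simp)
  have h1 := h w hw3
  have h2 := h (w ^ 2) (by linear_combination (w ^ 3 + 1) * hw3)
  refine ⟨?_, ?_, ?_⟩
  · linear_combination (h0 + h1 + h2) / 3 - (q + r * (w ^ 2 - w + 1)) / 3 * hw
  · linear_combination (h0 + w ^ 2 * h1 + w * h2) / 3 - (p + r) / 3 * hw -
      (2 * q + r * (w + w ^ 2)) / 3 * hw3
  · linear_combination (h0 + w * h1 + w ^ 2 * h2) / 3 - (p + q) / 3 * hw -
      (q * w + r * (w ^ 3 + 2)) / 3 * hw3

lemma exists_smul_hesseCubicThrough_eq {s : ℂ} (hs : s ^ 3 ≠ 1)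
    {e : Fin 10 → ℂ}
    (h : ∀ t : ℂ, t ^ 3 = 1 → eval ![s, t, t ^ 2] (ternaryCubic e) = 0 ∧
      eval ![1, s * t, t ^ 2] (ternaryCubic e) = 0 ∧
      eval ![1, t, s * t ^ 2] (ternaryCubic e) = 0) :
    ∃ k : ℂ, k • hesseCubicThrough s = ternaryCubic e := by
  simp only [ternaryCubic, map_add, map_mul, map_pow, eval_C, eval_X, Matrix.cons_val] at h
  obtain ⟨hx0, hx1, hx2⟩ := eq_zero_of_weights
    (p := s ^ 3 * e 0 + e 1 + e 2 + s * e 3) (q := s ^ 2 * e 4 + e 5 + s * e 6)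
    (r := e 9 + s * e 8 + s ^ 2 * e 7) fun t ht => by
      linear_combination (h t ht).1 - (e 1 + e 2 * (t ^ 3 + 1) + e 3 * s +
        t * (e 5 + e 6 * s) + t ^ 2 * e 9) * ht
  obtain ⟨hy0, hy1, hy2⟩ := eq_zero_of_weights
    (p := e 0 + s ^ 3 * e 1 + e 2 + s * e 3) (q := s * e 4 + s ^ 2 * e 5 + e 6)
    (r := s * e 9 + s ^ 2 * e 8 + e 7) fun t ht => by
      linear_combination (h t ht).2.1 - (e 1 * s ^ 3 + e 2 * (t ^ 3 + 1) + e 3 * s +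
        t * (e 5 * s ^ 2 + e 6) + t ^ 2 * (e 9 * s)) * ht
  obtain ⟨hz0, hz1, hz2⟩ := eq_zero_of_weights
    (p := e 0 + e 1 + s ^ 3 * e 2 + s * e 3) (q := e 4 + s * e 5 + s ^ 2 * e 6)
    (r := s ^ 2 * e 9 + e 8 + s * e 7) fun t ht => by
      linear_combination (h t ht).2.2 - (e 1 + e 2 * s ^ 3 * (t ^ 3 + 1) + e 3 * s +
        t * (e 5 * s + e 6 * s ^ 2) + t ^ 2 * (e 9 * s ^ 2)) * ht
  obtain ⟨h4, h5, h6⟩ := eq_zero_of_circulant hs hx1 hy1 hz1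
  obtain ⟨h9, h8, h7⟩ := eq_zero_of_circulant hs
    (b := e 9) (c := e 8) (d := e 7) (by linear_combination hz2)
    (by linear_combination hy2) (by linear_combination hx2)
  have h01 : e 1 = e 0 :=
    mul_left_cancel₀ (sub_ne_zero.mpr hs) (by linear_combination hy0 - hx0)
  have h02 : e 2 = e 0 :=
    mul_left_cancel₀ (sub_ne_zero.mpr hs) (by linear_combination hz0 - hx0)
  rw [h01, h02] at hx0
  obtain ⟨k, hk0, hk3⟩ : ∃ k, e 0 = k * s ∧ e 3 = -(k * (s ^ 3 + 2)) := by
    rcases eq_or_ne s 0 with rfl | hs0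
    · exact ⟨-e 3 / 2, by linear_combination hx0 / 2, by ring⟩
    · refine ⟨e 0 / s, by field_simp, ?_⟩
      field_simp
      linear_combination hx0
  refine ⟨k, ?_⟩
  simp only [h01, h02, hk0, hk3, h4, h5, h6, h7, h8, h9, ternaryCubic, hesseCubicThrough, smul_eq_C_mul,
    map_mul, map_neg, map_zero]
  ring

lemma dualHessePartial_cusp {s t : ℂ} (ht : t ^ 3 = 1) :
    (dualHessePartial s s t (t ^ 2) = 0 ∧ dualHessePartial s t (t ^ 2) s = 0 ∧
      dualHessePartial s (t ^ 2) s t = 0) ∧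
    (dualHessePartial s 1 (s * t) (t ^ 2) = 0 ∧ dualHessePartial s (s * t) (t ^ 2) 1 = 0 ∧
      dualHessePartial s (t ^ 2) 1 (s * t) = 0) ∧
    (dualHessePartial s 1 t (s * t ^ 2) = 0 ∧ dualHessePartial s t (s * t ^ 2) 1 = 0 ∧
      dualHessePartial s (s * t ^ 2) 1 t = 0) := by
  unfold dualHessePartial
  refine ⟨⟨?_, ?_, ?_⟩, ⟨?_, ?_, ?_⟩, ?_, ?_, ?_⟩ <;> grind

lemma hesseCubicThrough_isHomogeneous (s : ℂ) : (hesseCubicThrough s).IsHomogeneous 3 := by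
  refine IsHomogeneous.sub (IsHomogeneous.C_mul (((isHomogeneous_X_pow 0 3).add
    (isHomogeneous_X_pow 1 3)).add (isHomogeneous_X_pow 2 3)) _) (IsHomogeneous.C_mul ?_ _)
  exact ((isHomogeneous_X ℂ 0).mul (isHomogeneous_X ℂ 1)).mul (isHomogeneous_X ℂ 2)

lemma hesseCubicThrough_ne_zero (s : ℂ) : hesseCubicThrough s ≠ 0 := by
  intro h
  have h0 : s = 0 := by simpa [hesseCubicThrough] using congrArg (eval ![1, 0, 0]) h
  have h1 := congrArg (eval ![1, 1, 1]) h
  simp [hesseCubicThrough, h0] at h1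

lemma cusp_parameter_pow_three_ne_one {a c : ℂ} (ha : a ≠ 0) (hc : c ≠ 0) (h1 : a ^ 3 ≠ c ^ 3)
    (h2 : a ^ 3 ≠ -8 * c ^ 3) : ((4 * c ^ 3 - a ^ 3) / (3 * a ^ 2 * c)) ^ 3 ≠ 1 := by
  intro h
  rw [div_pow, div_eq_one_iff_eq (by simp [ha, hc])] at h
  have h' : (a ^ 3 - c ^ 3) * (a ^ 3 + 8 * c ^ 3) ^ 2 = 0 := by linear_combination -h
  rcases mul_eq_zero.mp h' with h' | h'
  · exact h1 (sub_eq_zero.mp h')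
  · exact h2 (by linear_combination pow_eq_zero_iff (two_ne_zero) |>.mp h')

/-- For `[a:c] ∉ T₁ ∪ T₂` the vector space of homogeneous cubics vanishing at all nine
singular points of the sextic `F_{a,c}` is one-dimensional: up to scalar there is a
unique plane cubic through the nine cusps of `𝐁`. -/
theorem unique_cubic_through_cusps (a c : ℂ)
    (ha : a ≠ 0) (hc : c ≠ 0) (h1 : a ^ 3 ≠ c ^ 3) (h2 : a ^ 3 ≠ -8 * c ^ 3) :
    Module.finrank ℂ (cubicsThroughCusps a c) = 1 := by
  have hs := cusp_parameter_pow_three_ne_one ha hc h1 h2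
  have hmem : hesseCubicThrough ((4 * c ^ 3 - a ^ 3) / (3 * a ^ 2 * c)) ∈
      cubicsThroughCusps a c := by
    refine mem_cubicsThroughCusps_iff.mpr ⟨hesseCubicThrough_isHomogeneous _, fun P hP => ?_⟩
    obtain ⟨hx, hy, hz⟩ := (mem_singularLocus_iff ha hc P).mp hP
    have h := hesseCubic_eq_zero_of_dualHessePartial_eq_zero hs hx hy hz
    simp only [hesseCubicThrough, map_sub, map_mul, map_add, map_pow, eval_C, eval_X]
    exact sub_eq_zero.mpr h
  refine finrank_eq_one ⟨_, hmem⟩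
    (fun h => hesseCubicThrough_ne_zero _ (congrArg Subtype.val h)) ?_
  rintro ⟨H, hH⟩
  obtain ⟨e, rfl⟩ := (mem_cubicsThroughCusps_iff.mp hH).1.exists_eq_ternaryCubic
  obtain ⟨k, hk⟩ := exists_smul_hesseCubicThrough_eq hs (e := e) fun t ht => by
    have ht0 : t ≠ 0 := by rintro rfl; simp at ht
    obtain ⟨⟨p0, p1, p2⟩, ⟨q0, q1, q2⟩, r0, r1, r2⟩ := dualHessePartial_cusp
      (s := (4 * c ^ 3 - a ^ 3) / (3 * a ^ 2 * c)) ht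
    exact ⟨eval_eq_zero_of_mem_cubicsThroughCusps ha hc hH
        (fun h => ht0 (congrFun h 1)) p0 p1 p2,
      eval_eq_zero_of_mem_cubicsThroughCusps ha hc hH
        (fun h => one_ne_zero (congrFun h 0)) q0 q1 q2,
      eval_eq_zero_of_mem_cubicsThroughCusps ha hc hH
        (fun h => one_ne_zero (congrFun h 0)) r0 r1 r2⟩
  exact ⟨k, Subtype.ext hk⟩
end
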